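/- arXiv:0801.0684 — 8 statements merged into one kernel-verified Lean document; each statement's English description precedes it below -/
import Mathlib

section
/- Let D_o be the operator taking a function G : ℝ → ℝ to the function r ↦ deriv (s ↦ G s / s) r. For all natural numbers m, p with p ≥ m and every real r ≠ 0, the m-fold iterate of D_o applied to the function r ↦ r^(2p+1), evaluated at r, equals ((2p)‼ / (2p-2m)‼) · r^(2p+1-2m). -/
open Nat

/-- The "odd" radial Fueter–Sce operator `∂_r (1/r)`. -/
noncomputable def Do (G : ℝ → ℝ) : ℝ → ℝ := fun r => deriv (fun s => G s / s) r

theorem Do_apply_of_eqOn_const_mul_pow {G : ℝ → ℝ} {c : ℝ} {n : ℕ}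
    (hG : ∀ s : ℝ, s ≠ 0 → G s = c * s ^ (n + 2)) {r : ℝ} (hr : r ≠ 0) :
    Do G r = c * (n + 1) * r ^ n := by
  have hquot : (fun s => G s / s) =ᶠ[nhds r] fun s => c * s ^ (n + 1) := by
    filter_upwards [isOpen_ne.mem_nhds hr] with s hs
    have hs : s ≠ 0 := hs
    rw [hG s hs]
    field_simp
    ring
  have hderiv : HasDerivAt (fun s : ℝ => c * s ^ (n + 1)) (c * (n + 1) * r ^ n) r := by
    simpa [mul_assoc] using (hasDerivAt_pow (n + 1) r).const_mul c
  exact hquot.deriv_eq.trans hderiv.deriv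

theorem Do_iterate_pow_add (m k : ℕ) {r : ℝ} (hr : r ≠ 0) :
    (Do^[m] (fun s : ℝ => s ^ (2 * (m + k) + 1))) r =
      ((2 * (m + k))‼ : ℝ) / ((2 * k)‼ : ℝ) * r ^ (2 * k + 1) := by
  induction m generalizing k r with
  | zero =>
    have : ((2 * k)‼ : ℝ) ≠ 0 := by exact_mod_cast (Nat.doubleFactorial_pos _).ne'
    simp [this]
  | succ m ih =>
    have hk : m + 1 + k = m + (k + 1) := by omega
    rw [Function.iterate_succ_apply', hk,
      Do_apply_of_eqOn_const_mul_pow (n := 2 * k + 1) (fun s hs => ih (k + 1) hs) hr]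
    have : ((2 * k)‼ : ℝ) ≠ 0 := by exact_mod_cast (Nat.doubleFactorial_pos _).ne'
    rw [show 2 * (k + 1) = 2 * k + 2 by ring, Nat.doubleFactorial_add_two (2 * k)]
    push_cast
    field_simp
    ring

/-- For `p ≥ m` and `r ≠ 0`, the `m`-fold iterate of `D_o` applied to `r ↦ r^(2p+1)`
equals `((2p)‼ / (2p-2m)‼) r^(2p+1-2m)`. -/
theorem Do_iterate_odd_pow (m p : ℕ) (hmp : m ≤ p) (r : ℝ) (hr : r ≠ 0) :
    (Do^[m] (fun s : ℝ => s ^ (2 * p + 1))) r =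
      ((2 * p)‼ : ℝ) / ((2 * p - 2 * m)‼ : ℝ) * r ^ (2 * p + 1 - 2 * m) := by
  obtain ⟨k, rfl⟩ := Nat.exists_eq_add_of_le hmp
  rw [show 2 * (m + k) - 2 * m = 2 * k by omega,
    show 2 * (m + k) + 1 - 2 * m = 2 * k + 1 by omega]
  exact Do_iterate_pow_add m k hr
end

section
/- Let D_o be the operator taking a function G : ℝ → ℝ to the function r ↦ deriv (s ↦ G s / s) r. For all natural numbers m, p with p < m and every real r ≠ 0, the m-fold iterate of D_o applied to the function r ↦ r^(2p+1), evaluated at r, equals 0. -/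
theorem Set.EqOn.do_compl_zero {G H : ℝ → ℝ} (h : Set.EqOn G H {0}ᶜ) :
    Set.EqOn (Do G) (Do H) {0}ᶜ := by
  intro r hr
  apply Filter.EventuallyEq.deriv_eq
  filter_upwards [isOpen_compl_singleton.mem_nhds hr] with s hs
  rw [h hs]

theorem Do_const_mul_odd_pow (c : ℝ) (p : ℕ) :
    Set.EqOn (Do fun s => c * s ^ (2 * p + 1)) (fun s => c * (2 * p) * s ^ (2 * p - 1)) {0}ᶜ := by
  intro r hr
  have h : (fun s : ℝ => c * s ^ (2 * p + 1) / s) =ᶠ[nhds r] fun s => c * s ^ (2 * p) := by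
    filter_upwards [isOpen_compl_singleton.mem_nhds hr] with s hs
    rw [pow_succ, ← mul_assoc, mul_div_cancel_right₀ _ hs]
  simp only [Do]
  rw [h.deriv_eq, ((hasDerivAt_pow (2 * p) r).const_mul c).deriv]
  push_cast
  ring

theorem Do_iterate_eqOn_zero {G : ℝ → ℝ} {c : ℝ} {m p : ℕ} (hmp : p < m)
    (hG : Set.EqOn G (fun s => c * s ^ (2 * p + 1)) {0}ᶜ) : Set.EqOn (Do^[m] G) 0 {0}ᶜ := by
  induction m generalizing G c p with
  | zero => omega
  | succ m ih =>
    have hDo := hG.do_compl_zero.trans (Do_const_mul_odd_pow c p)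
    rw [Function.iterate_succ_apply]
    cases p with
    | zero =>
      have hzero : Set.EqOn (Do G) 0 {0}ᶜ := fun s hs => by simp [hDo hs]
      cases m with
      | zero => exact hzero
      | succ m => exact ih (c := 0) (p := 0) (by omega) fun s hs => by simp [hzero hs]
    | succ p => exact ih (by omega) hDo

/-- For `p < m` and `r ≠ 0`, the `m`-fold iterate of `D_o` applied to `r ↦ r^(2p+1)`
vanishes at `r`. -/
theorem Do_iterate_odd_pow_eq_zero (m p : ℕ) (hmp : p < m) (r : ℝ) (hr : r ≠ 0) :
    (Do^[m] (fun s : ℝ => s ^ (2 * p + 1))) r = 0 := by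
  exact Do_iterate_eqOn_zero (c := 1) hmp (fun s _ => (one_mul _).symm) hr
end

section
/- Let D_e be the operator taking a function F : ℝ → ℝ to the function r ↦ (deriv F r)/r, and for k ∈ ℕ, x0 ∈ ℝ let u_k(x0, ·) : ℝ → ℝ be y ↦ ∑_{p=0}^{⌊k/2⌋} binom(k,2p)(-1)^p y^(2p) x0^(k-2p). Then for every natural m, every k ∈ ℕ, every x0 ∈ ℝ and every real r ≠ 0, the m-fold iterate of D_e applied to u_k(x0, ·), evaluated at r, equals ∑_{p=m}^{⌊k/2⌋} binom(k,2p)(-1)^p x0^(k-2p) · ((2p)‼/(2p-2m)‼) · r^(2p-2m). -/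
open Nat Finset

/-- The "even" radial Fueter–Sce operator `(1/r) ∂_r`. -/
noncomputable def De (F : ℝ → ℝ) : ℝ → ℝ := fun r => deriv F r / r

/-- `u_k(w, y)`: the real part of `(w + i y)^k`. -/
noncomputable def uFun (k : ℕ) (w y : ℝ) : ℝ :=
  ∑ p ∈ Finset.range (k / 2 + 1),
    (k.choose (2 * p) : ℝ) * (-1) ^ p * y ^ (2 * p) * w ^ (k - 2 * p)

/-- `De` of a function that agrees with `∑ p ∈ s, c p * y ^ e p` away from the origin. -/
theorem De_eq_sum_of_eq_sum (F : ℝ → ℝ) (s : Finset ℕ) (c : ℕ → ℝ) (e : ℕ → ℕ)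
    (hF : ∀ y, y ≠ 0 → F y = ∑ p ∈ s, c p * y ^ e p) {r : ℝ} (hr : r ≠ 0) :
    De F r = ∑ p ∈ s, c p * (e p * r ^ (e p - 1)) / r := by
  have hev : F =ᶠ[nhds r] fun y => ∑ p ∈ s, c p * y ^ e p := by
    filter_upwards [isOpen_ne.mem_nhds hr] with y hy using hF y hy
  have hd : HasDerivAt (fun y => ∑ p ∈ s, c p * y ^ e p)
      (∑ p ∈ s, c p * (e p * r ^ (e p - 1))) r :=
    HasDerivAt.fun_sum fun p _ => (hasDerivAt_pow (e p) r).const_mul (c p)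
  rw [De, hev.deriv_eq, hd.deriv, Finset.sum_div]

/-- The `m`-fold iterate of `D_e` applied to `u_k(x0, ·)` evaluated at `r ≠ 0`. -/
theorem De_iterate_u (m k : ℕ) (x0 : ℝ) (r : ℝ) (hr : r ≠ 0) :
    (De^[m] (fun y => uFun k x0 y)) r =
      ∑ p ∈ Finset.Icc m (k / 2),
        (k.choose (2 * p) : ℝ) * (-1) ^ p * x0 ^ (k - 2 * p) *
          (((2 * p)‼ : ℝ) / ((2 * p - 2 * m)‼ : ℝ)) * r ^ (2 * p - 2 * m) := by
  induction m generalizing r with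
  | zero =>
    have hne (p : ℕ) : ((2 * p)‼ : ℝ) ≠ 0 := by exact_mod_cast (Nat.doubleFactorial_pos _).ne'
    rw [Function.iterate_zero_apply, uFun, Finset.range_eq_Ico]
    refine Finset.sum_congr (by ext; simp) fun p _ => ?_
    rw [Nat.mul_zero, Nat.sub_zero, div_self (hne p)]
    ring
  | succ m ih =>
    rw [Function.iterate_succ_apply', De_eq_sum_of_eq_sum _ _ _ _ (fun y hy => ih y hy) hr]
    symm
    refine Finset.sum_subset_zero_on_sdiff (Finset.Icc_subset_Icc_left m.le_succ) ?_ ?_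
    · intro p hp
      obtain rfl : p = m := by
        simp only [Finset.mem_sdiff, Finset.mem_Icc] at hp
        lia
      simp
    · intro p hp
      obtain ⟨d, rfl⟩ := Nat.exists_eq_add_of_le (Finset.mem_Icc.mp hp).1
      have h₁ : 2 * (m + 1 + d) - 2 * m = 2 * d + 2 := by lia
      have h₂ : 2 * (m + 1 + d) - 2 * (m + 1) = 2 * d := by lia
      have hne : ((2 * d)‼ : ℝ) ≠ 0 := by exact_mod_cast (Nat.doubleFactorial_pos _).ne'
      have hd : (2 * (d : ℝ) + 2) ≠ 0 := by positivity
      rw [h₁, h₂, Nat.doubleFactorial_add_two, show 2 * d + 2 - 1 = 2 * d + 1 by lia]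
      push_cast
      field_simp
      ring
end

section
/- Let D_o be the operator taking a function G : ℝ → ℝ to the function r ↦ deriv (s ↦ G s / s) r, and for k ∈ ℕ, x0 ∈ ℝ let v_k(x0, ·) : ℝ → ℝ be y ↦ ∑_{p=0}^{⌊(k-1)/2⌋} binom(k,2p+1)(-1)^p y^(2p+1) x0^(k-2p-1). Then for every natural m, every k ∈ ℕ, every x0 ∈ ℝ and every real r ≠ 0, the m-fold iterate of D_o applied to v_k(x0, ·), evaluated at r, equals ∑_{p=m}^{⌊(k-1)/2⌋} binom(k,2p+1)(-1)^p x0^(k-2p-1) · ((2p)‼/(2p-2m)‼) · r^(2p+1-2m). -/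
open Nat Finset

/-- `v_k(w, y)`: the imaginary part of `(w + i y)^k`. -/
noncomputable def vFun (k : ℕ) (w y : ℝ) : ℝ :=
  ∑ p ∈ Finset.range ((k - 1) / 2 + 1),
    (k.choose (2 * p + 1) : ℝ) * (-1) ^ p * y ^ (2 * p + 1) * w ^ (k - 2 * p - 1)

/-- `Do` at a nonzero point only depends on the values of the function away from zero. -/
lemma Do_eq_of_eq_on_ne_zero {G H : ℝ → ℝ} (h : ∀ s ≠ 0, G s = s * H s) {r H' : ℝ}
    (hr : r ≠ 0) (hH : HasDerivAt H H' r) : Do G r = H' := by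
  refine (hH.congr_of_eventuallyEq ?_).deriv
  filter_upwards [isOpen_ne.mem_nhds hr] with s hs
  rw [h s hs, mul_div_cancel_left₀ _ hs]

/-- The iterates of `Do` on an odd polynomial. -/
lemma Do_iterate_odd_polynomial (c : ℕ → ℝ) (N m : ℕ) (r : ℝ) (hr : r ≠ 0) :
    (Do^[m] (fun y => ∑ p ∈ Finset.range (N + 1), c p * y ^ (2 * p + 1))) r =
      ∑ p ∈ Finset.Icc m N,
        c p * (((2 * p)‼ : ℝ) / ((2 * p - 2 * m)‼ : ℝ)) * r ^ (2 * p + 1 - 2 * m) := by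
  induction m generalizing r with
  | zero =>
    have hd (p : ℕ) : ((2 * p)‼ : ℝ) ≠ 0 := by
      exact_mod_cast (Nat.doubleFactorial_pos _).ne'
    simp [Finset.range_eq_Ico, Finset.Ico_add_one_right_eq_Icc, hd]
  | succ m ih =>
    rw [Function.iterate_succ_apply']
    have hfactor : ∀ s : ℝ, s ≠ 0 →
        (Do^[m] (fun y => ∑ p ∈ Finset.range (N + 1), c p * y ^ (2 * p + 1))) s =
          s * ∑ p ∈ Finset.Icc m N,
            c p * (((2 * p)‼ : ℝ) / ((2 * p - 2 * m)‼ : ℝ)) * s ^ (2 * p - 2 * m) := by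
      intro s hs
      rw [ih s hs, Finset.mul_sum]
      refine Finset.sum_congr rfl fun p hp => ?_
      have hmp := (Finset.mem_Icc.mp hp).1
      rw [show 2 * p + 1 - 2 * m = (2 * p - 2 * m) + 1 by lia]
      ring
    rw [Do_eq_of_eq_on_ne_zero hfactor hr (HasDerivAt.fun_sum fun p _ =>
      (hasDerivAt_pow (2 * p - 2 * m) r).const_mul _)]
    symm
    refine Finset.sum_subset_zero_on_sdiff (Finset.Icc_subset_Icc_left m.le_succ) ?_ ?_
    · intro p hp
      obtain rfl : p = m := by
        simp only [Finset.mem_sdiff, Finset.mem_Icc] at hp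
        lia
      simp
    · intro p hp
      obtain ⟨q, rfl⟩ := Nat.exists_eq_add_of_le (Finset.mem_Icc.mp hp).1
      rw [show 2 * (m + 1 + q) - 2 * (m + 1) = 2 * q by lia,
        show 2 * (m + 1 + q) - 2 * m = 2 * q + 2 by lia,
        show 2 * (m + 1 + q) + 1 - 2 * (m + 1) = 2 * q + 1 by lia,
        show 2 * q + 2 - 1 = 2 * q + 1 by lia, Nat.doubleFactorial_add_two]
      have hd : ((2 * q)‼ : ℝ) ≠ 0 := by
        exact_mod_cast (Nat.doubleFactorial_pos _).ne'
      push_cast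
      field_simp

/-- The `m`-fold iterate of `D_o` applied to `v_k(x0, ·)` evaluated at `r ≠ 0`. -/
theorem Do_iterate_v (m k : ℕ) (x0 : ℝ) (r : ℝ) (hr : r ≠ 0) :
    (Do^[m] (fun y => vFun k x0 y)) r =
      ∑ p ∈ Finset.Icc m ((k - 1) / 2),
        (k.choose (2 * p + 1) : ℝ) * (-1) ^ p * x0 ^ (k - 2 * p - 1) *
          (((2 * p)‼ : ℝ) / ((2 * p - 2 * m)‼ : ℝ)) * r ^ (2 * p + 1 - 2 * m) := by
  have hv : (fun y => vFun k x0 y) = fun y => ∑ p ∈ Finset.range ((k - 1) / 2 + 1),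
      ((k.choose (2 * p + 1) : ℝ) * (-1) ^ p * x0 ^ (k - 2 * p - 1)) * y ^ (2 * p + 1) :=
    funext fun y => Finset.sum_congr rfl fun p _ => mul_right_comm _ _ _
  rw [hv]
  exact Do_iterate_odd_polynomial _ _ m r hr
end

section
/- Let D_e map F : ℝ → ℝ to r ↦ (deriv F r)/r and D_o map G : ℝ → ℝ to r ↦ deriv (s ↦ G s / s) r. Let u_k(w,y) = ∑_{p=0}^{⌊k/2⌋} binom(k,2p)(-1)^p y^(2p) w^(k-2p) and v_k(w,y) = ∑_{p=0}^{⌊(k-1)/2⌋} binom(k,2p+1)(-1)^p y^(2p+1) w^(k-2p-1). Then for every natural m ≥ 1, every k < 2m, every x0 ∈ ℝ and every real r ≠ 0, the m-fold iterate of D_e applied to y ↦ u_k(x0,y) vanishes at r, and the m-fold iterate of D_o applied to y ↦ v_k(x0,y) vanishes at r. -/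
open Nat Finset

theorem eventuallyEq_nhds_of_forall_ne_zero {F G : ℝ → ℝ} (h : ∀ y, y ≠ 0 → F y = G y)
    {r : ℝ} (hr : r ≠ 0) : F =ᶠ[nhds r] G :=
  Filter.eventually_of_mem (isOpen_ne.mem_nhds hr) h

/-- Applying `De` to an even polynomial function lowers its number of coefficients by one. -/
theorem De_even_sum (n : ℕ) (c : ℕ → ℝ) (F : ℝ → ℝ)
    (hF : ∀ y, y ≠ 0 → F y = ∑ p ∈ range (n + 1), c p * y ^ (2 * p)) (r : ℝ) (hr : r ≠ 0) :
    De F r = ∑ p ∈ range n, c (p + 1) * (2 * (p + 1)) * r ^ (2 * p) := by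
  have hd : HasDerivAt (fun y : ℝ => ∑ p ∈ range (n + 1), c p * y ^ (2 * p))
      (∑ p ∈ range (n + 1), c p * (((2 * p : ℕ) : ℝ) * r ^ (2 * p - 1))) r :=
    HasDerivAt.fun_sum fun p _ => (hasDerivAt_pow (2 * p) r).const_mul (c p)
  unfold De
  rw [(eventuallyEq_nhds_of_forall_ne_zero hF hr).deriv_eq, hd.deriv, sum_range_succ',
    div_eq_iff hr, sum_mul]
  simp only [mul_zero, Nat.cast_zero, zero_mul, add_zero]
  refine sum_congr rfl fun p _ => ?_
  rw [show 2 * (p + 1) - 1 = 2 * p + 1 by lia]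
  push_cast
  ring

/-- The `m`-fold iterate of `De` annihilates even polynomial functions of degree below `2m`. -/
theorem De_iterate_even_sum (m n : ℕ) (hn : n ≤ m) (c : ℕ → ℝ) (F : ℝ → ℝ)
    (hF : ∀ y, y ≠ 0 → F y = ∑ p ∈ range n, c p * y ^ (2 * p)) (r : ℝ) (hr : r ≠ 0) :
    (De^[m] F) r = 0 := by
  induction m generalizing n c F with
  | zero =>
    obtain rfl : n = 0 := by lia
    simpa using hF r hr
  | succ m ih =>
    rw [Function.iterate_succ_apply]
    cases n with
    | zero =>
      refine ih 0 (Nat.zero_le m) c (De F) fun y hy => ?_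
      refine (De_even_sum 0 0 F (fun z hz => ?_) y hy).trans (by simp)
      simpa using hF z hz
    | succ n => exact ih n (by lia) _ (De F) (De_even_sum n c F hF)

/-- Away from the origin, division by the variable intertwines `Do` and `De`. -/
theorem Do_iterate_eq_mul_De_iterate (m : ℕ) (F G : ℝ → ℝ) (h : ∀ y, y ≠ 0 → G y = y * F y)
    (r : ℝ) (hr : r ≠ 0) : (Do^[m] G) r = r * (De^[m] F) r := by
  induction m generalizing F G with
  | zero => exact h r hr
  | succ m ih =>
    rw [Function.iterate_succ_apply, Function.iterate_succ_apply]
    refine ih (De F) (Do G) fun y hy => ?_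
    have hq : ∀ s, s ≠ 0 → G s / s = F s := fun s hs => by
      rw [h s hs, mul_div_cancel_left₀ _ hs]
    unfold Do De
    rw [(eventuallyEq_nhds_of_forall_ne_zero hq hy).deriv_eq, mul_div_cancel₀ _ hy]

/-- The Fueter–Sce transform of `z^k` vanishes identically for `k < n - 1 = 2m`. -/
theorem fueterSce_monomial_vanishes (m k : ℕ) (hm : 1 ≤ m) (hk : k < 2 * m)
    (x0 : ℝ) (r : ℝ) (hr : r ≠ 0) :
    (De^[m] (fun y => uFun k x0 y)) r = 0 ∧
      (Do^[m] (fun y => vFun k x0 y)) r = 0 := by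
  constructor
  · refine De_iterate_even_sum m (k / 2 + 1) (by lia)
      (fun p => (k.choose (2 * p) : ℝ) * (-1) ^ p * x0 ^ (k - 2 * p)) _ (fun y _ => ?_) r hr
    exact sum_congr rfl fun p _ => by ring
  · let c : ℕ → ℝ := fun p => (k.choose (2 * p + 1) : ℝ) * (-1) ^ p * x0 ^ (k - 2 * p - 1)
    let F : ℝ → ℝ := fun y => ∑ p ∈ range ((k - 1) / 2 + 1), c p * y ^ (2 * p)
    rw [Do_iterate_eq_mul_De_iterate m F _ (fun y _ => ?_) r hr,
      De_iterate_even_sum m _ (by lia) c F (fun _ _ => rfl) r hr, mul_zero]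
    simp only [vFun, F, c, mul_sum]
    exact sum_congr rfl fun p _ => by ring
end

section
/- Let n ≥ 2 be a natural number, γ a real number, and a : ℕ → ℝ a sequence satisfying the recurrence a(k+n-1) = γ · k! · a(k) / (k+n-1)! for all k ∈ ℕ. Then for all natural numbers l and all r with 0 ≤ r ≤ n-2, one has a(l·(n-1)+r) = γ^l · r! · a(r) / (l·(n-1)+r)!. -/
open Nat

/-- Explicit solution of the recurrence `a(k+n-1) = γ k! a(k)/(k+n-1)!`:
`a(l(n-1)+r) = γ^l r! a(r)/(l(n-1)+r)!` for `0 ≤ r ≤ n-2`. -/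
theorem recurrence_solution (n : ℕ) (hn : 2 ≤ n) (γ : ℝ) (a : ℕ → ℝ)
    (ha : ∀ k : ℕ, a (k + n - 1) = γ * (k ! : ℝ) * a k / ((k + n - 1)! : ℝ)) :
    ∀ l r : ℕ, r ≤ n - 2 →
      a (l * (n - 1) + r) = γ ^ l * (r ! : ℝ) * a r / (((l * (n - 1) + r)!) : ℝ) := by
  intro l r _
  induction l with
  | zero =>
    have hr : (r ! : ℝ) ≠ 0 := by positivity
    simp only [zero_mul, zero_add, pow_zero, one_mul]
    field_simp
  | succ l ih =>
    have hk : (l + 1) * (n - 1) + r = l * (n - 1) + r + n - 1 := by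
      rw [add_mul, one_mul]
      omega
    have hl : ((l * (n - 1) + r)! : ℝ) ≠ 0 := by positivity
    rw [hk, ha, ih]
    field_simp
    ring
end

section
/- Let n ≥ 2 be a natural number, γ a real number, and a : ℕ → ℝ a sequence satisfying a(k+n-1) = γ · k! · a(k) / (k+n-1)! for all k ∈ ℕ. Then for every complex number z, the family (a(k) · z^k)_{k ∈ ℕ} is (absolutely) summable; in particular the power series ∑ a(k) z^k has infinite radius of convergence and defines an entire function. -/
open Nat

/-- A sequence that is multiplied by `γ` under a positive shift grows at most geometrically. -/
theorem exists_abs_le_geometric_of_shift {m : ℕ} (hm : 0 < m) {γ : ℝ} {b : ℕ → ℝ}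
    (hb : ∀ k, b (k + m) = γ * b k) :
    ∃ C R : ℝ, ∀ k, |b k| ≤ C * R ^ k := by
  have hR : 1 ≤ max 1 |γ| := le_max_left _ _
  have hC : 0 ≤ ∑ i ∈ Finset.range m, |b i| := Finset.sum_nonneg fun i _ => abs_nonneg _
  refine ⟨∑ i ∈ Finset.range m, |b i|, max 1 |γ|, fun k => ?_⟩
  induction k using Nat.strong_induction_on with
  | _ k ih =>
    rcases lt_or_ge k m with h | h
    · calc |b k| ≤ ∑ i ∈ Finset.range m, |b i| :=
            Finset.single_le_sum (f := fun i => |b i|) (fun i _ => abs_nonneg _)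
              (Finset.mem_range.2 h)
        _ ≤ _ := le_mul_of_one_le_right hC (one_le_pow₀ hR)
    · obtain ⟨j, rfl⟩ := Nat.exists_eq_add_of_le' h
      calc |b (j + m)| = |γ| * |b j| := by rw [hb, abs_mul]
        _ ≤ max 1 |γ| * ((∑ i ∈ Finset.range m, |b i|) * max 1 |γ| ^ j) :=
            mul_le_mul (le_max_right _ _) (ih j (by omega)) (abs_nonneg _) (by positivity)
        _ = (∑ i ∈ Finset.range m, |b i|) * max 1 |γ| ^ (j + 1) := by ring
        _ ≤ _ := mul_le_mul_of_nonneg_left (pow_le_pow_right₀ hR (by omega)) hC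

/-- A coefficient sequence satisfying the recurrence `a(k+n-1) = γ k! a(k)/(k+n-1)!`
yields an everywhere (absolutely) summable power series `∑ a(k) z^k`. -/
theorem summable_of_recurrence (n : ℕ) (hn : 2 ≤ n) (γ : ℝ) (a : ℕ → ℝ)
    (ha : ∀ k : ℕ, a (k + n - 1) = γ * (k ! : ℝ) * a k / ((k + n - 1)! : ℝ)) (z : ℂ) :
    Summable (fun k : ℕ => ((a k : ℂ) * z ^ k)) := by
  obtain ⟨C, R, h⟩ := exists_abs_le_geometric_of_shift (m := n - 1) (by omega) (γ := γ)
    (b := fun k => (k ! : ℝ) * a k) fun k => by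
      have hk := ha k
      rw [Nat.add_sub_assoc (by omega)] at hk
      have h0 : ((k + (n - 1))! : ℝ) ≠ 0 := by positivity
      simp only [hk]
      field_simp
  refine Summable.of_norm_bounded
    ((Real.summable_pow_div_factorial (R * ‖z‖)).mul_left C) fun k => ?_
  have hk : (0 : ℝ) < k ! := by positivity
  have hle := h k
  rw [abs_mul, abs_of_pos hk] at hle
  rw [norm_mul, norm_pow, Complex.norm_real, Real.norm_eq_abs, ← mul_div_assoc, le_div_iff₀ hk]
  calc |a k| * ‖z‖ ^ k * k ! = k ! * |a k| * ‖z‖ ^ k := by ring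
    _ ≤ C * R ^ k * ‖z‖ ^ k := by gcongr
    _ = C * (R * ‖z‖) ^ k := by ring
end

section
/- Let n ≥ 2 be a natural number, γ a real number, and a : ℕ → ℝ a sequence satisfying a(k+n-1) = γ · k! · a(k) / (k+n-1)! for all k ∈ ℕ. Then for every complex number z, ∑'_{k ∈ ℕ} a(k) · z^k = ∑_{r=0}^{n-2} ( ∑'_{l ∈ ℕ} γ^l · r! · a(r) · z^(l·(n-1)+r) / (l·(n-1)+r)! ), where the outer sum is a finite sum over r and all series converge absolutely. -/
open Nat Finset

theorem apply_mul_add_eq_pow_mul {R : Type*} [Monoid R] {b : ℕ → R} {c : R} {m : ℕ}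
    (hb : ∀ k, b (k + m) = c * b k) (l r : ℕ) : b (l * m + r) = c ^ l * b r := by
  induction l with
  | zero => simp
  | succ l ih =>
    rw [show (l + 1) * m + r = l * m + r + m by ring, hb, ih, _root_.pow_succ', mul_assoc]

theorem summable_mul_pow_div_factorial {b : ℕ → ℂ} {c : ℂ} {m : ℕ} (hm : 0 < m)
    (hb : ∀ k, b (k + m) = c * b k) (z : ℂ) :
    Summable fun k ↦ b k * z ^ k / (k ! : ℂ) := by
  set M : ℝ := max 1 ‖c‖
  set C : ℝ := ∑ r ∈ Finset.range m, ‖b r‖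
  have hM : 1 ≤ M := le_max_left _ _
  have hbound (k : ℕ) : ‖b k‖ ≤ C * M ^ k := by
    have hk := apply_mul_add_eq_pow_mul hb (k / m) (k % m)
    rw [Nat.div_add_mod'] at hk
    rw [hk, norm_mul, norm_pow, mul_comm]
    have h_res : ‖b (k % m)‖ ≤ C :=
      Finset.single_le_sum (f := fun r ↦ ‖b r‖) (fun _ _ ↦ norm_nonneg _)
        (Finset.mem_range.2 (Nat.mod_lt k hm))
    have h_pow : ‖c‖ ^ (k / m) ≤ M ^ k :=
      (pow_le_pow_left₀ (norm_nonneg c) (le_max_right _ _) _).trans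
        (pow_le_pow_right₀ hM (Nat.div_le_self k m))
    gcongr
  refine Summable.of_norm_bounded
    ((Real.summable_pow_div_factorial (M * ‖z‖)).mul_left C) fun k ↦ ?_
  rw [norm_div, norm_mul, norm_pow, Complex.norm_natCast, mul_pow, ← mul_div_assoc, ← mul_assoc]
  gcongr
  exact hbound k

theorem tsum_eq_sum_range_tsum {E : Type*} [NormedAddCommGroup E] [CompleteSpace E] {f : ℕ → E}
    (hf : Summable f) {m : ℕ} (hm : 0 < m) :
    ∑' k, f k = ∑ r ∈ Finset.range m, ∑' l, f (l * m + r) := by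
  have : NeZero m := ⟨hm.ne'⟩
  let e : Fin m × ℕ ≃ ℕ := (Equiv.prodComm _ _).trans (Nat.divModEquiv m).symm
  have he : Summable fun p ↦ f (e p) := (e.summable_iff (f := f)).2 hf
  rw [← e.tsum_eq f, he.tsum_prod, tsum_fintype, Finset.sum_range]
  rfl

/-- The rearranged series expansion: for a coefficient sequence satisfying the
recurrence `a(k+n-1) = γ k! a(k)/(k+n-1)!`,
`∑ₖ a(k) zᵏ = ∑_{r=0}^{n-2} ∑ₗ γ^l r! a(r) z^{l(n-1)+r} / (l(n-1)+r)!`. -/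
theorem tsum_rearranged (n : ℕ) (hn : 2 ≤ n) (γ : ℝ) (a : ℕ → ℝ)
    (ha : ∀ k : ℕ, a (k + n - 1) = γ * (k ! : ℝ) * a k / ((k + n - 1)! : ℝ)) (z : ℂ) :
    ∑' k : ℕ, (a k : ℂ) * z ^ k =
      ∑ r ∈ Finset.range (n - 1),
        ∑' l : ℕ, (γ : ℂ) ^ l * (r ! : ℂ) * (a r : ℂ) * z ^ (l * (n - 1) + r) /
          (((l * (n - 1) + r)!) : ℂ) := by
  have hm : 0 < n - 1 := by omega
  have h_fact (k : ℕ) : (k ! : ℂ) ≠ 0 := Nat.cast_ne_zero.2 k.factorial_ne_zero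
  let b : ℕ → ℂ := fun k ↦ (k ! : ℂ) * (a k : ℂ)
  have hb (k : ℕ) : b (k + (n - 1)) = (γ : ℂ) * b k := by
    simp only [b]
    rw [← Nat.add_sub_assoc (by omega : 1 ≤ n) k, ha k]
    push_cast
    rw [mul_div_cancel₀ _ (h_fact _), mul_assoc]
  have h_term (k : ℕ) : (a k : ℂ) * z ^ k = b k * z ^ k / (k ! : ℂ) := by
    simp only [b]
    field_simp [h_fact k]
  simp_rw [h_term]
  rw [tsum_eq_sum_range_tsum (summable_mul_pow_div_factorial hm hb z) hm]
  refine Finset.sum_congr rfl fun r _ ↦ tsum_congr fun l ↦ ?_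
  rw [apply_mul_add_eq_pow_mul hb, ← mul_assoc]
end
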